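/- arXiv:math/9903172 — 2 statements merged into one kernel-verified Lean document; each statement's English description precedes it below -/
import Mathlib

section
/- Let X be a metric space, γ : [0, ∞) → X a ray with associated Busemann function b, and x₀ ∈ X. Let R_i → ∞ be a sequence of positive reals, set L_i = d(x₀, γ(R_i)), and let σ_i : [0, L_i] → X be minimizing geodesics with σ_i(0) = x₀ and σ_i(L_i) = γ(R_i). Suppose σ : [0, ∞) → X is a map such that for every t ≥ 0, σ_i(t) → σ(t) as i → ∞ (where σ_i(t) is considered for all i large enough that L_i ≥ t). Then σ is a ray with σ(0) = x₀, and b(σ(t)) = b(x₀) + t for all t ≥ 0. -/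
open Filter Topology

/-- Let `b` be the Busemann function of a ray `γ`, `x₀ ∈ X`, `R i → ∞`
positive, `L i = d(x₀, γ (R i))`, and `σs i : [0, L i] → X` minimizing geodesics from
`x₀` to `γ (R i)`. If `σ : [0,∞) → X` is a pointwise limit of the `σs i`, then `σ` is
a ray with `σ 0 = x₀` and `b (σ t) = b x₀ + t` for all `t ≥ 0`. -/
theorem limit_of_minimizing_geodesics_is_ray {X : Type*} [MetricSpace X] (γ : ℝ → X)
    (hγ : ∀ s t : ℝ, 0 ≤ s → 0 ≤ t → dist (γ s) (γ t) = |s - t|)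
    (b : X → ℝ)
    (hb : ∀ x : X, Filter.Tendsto (fun R : ℝ => R - dist x (γ R))
        Filter.atTop (nhds (b x)))
    (x₀ : X) (R : ℕ → ℝ) (hRpos : ∀ i, 0 < R i)
    (hR : Filter.Tendsto R Filter.atTop Filter.atTop)
    (L : ℕ → ℝ) (hL : ∀ i, L i = dist x₀ (γ (R i)))
    (σs : ℕ → ℝ → X)
    (hσs : ∀ i, ∀ s t : ℝ, 0 ≤ s → s ≤ L i → 0 ≤ t → t ≤ L i →
        dist (σs i s) (σs i t) = |s - t|)
    (hσs0 : ∀ i, σs i 0 = x₀)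
    (hσsL : ∀ i, σs i (L i) = γ (R i))
    (σ : ℝ → X)
    (hconv : ∀ t : ℝ, 0 ≤ t →
        Filter.Tendsto (fun i => σs i t) Filter.atTop (nhds (σ t))) :
    (∀ s t : ℝ, 0 ≤ s → 0 ≤ t → dist (σ s) (σ t) = |s - t|) ∧
    σ 0 = x₀ ∧
    (∀ t : ℝ, 0 ≤ t → b (σ t) = b x₀ + t) := by
  have hLtop : Tendsto L atTop atTop := by
    refine tendsto_atTop_mono (fun i => ?_) (tendsto_atTop_add_const_right _ (-dist x₀ (γ 0)) hR)
    have h := hγ 0 (R i) le_rfl (hRpos i).le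
    rw [zero_sub, abs_neg, abs_of_pos (hRpos i)] at h
    have h' := dist_triangle_left (γ 0) (γ (R i)) x₀
    rw [hL i]
    linarith
  refine ⟨fun s t hs ht => ?_, ?_, fun t ht => ?_⟩
  · refine tendsto_nhds_unique ((hconv s hs).dist (hconv t ht))
      (tendsto_const_nhds.congr' ?_)
    filter_upwards [hLtop.eventually_ge_atTop s, hLtop.eventually_ge_atTop t] with i his hit
    exact (hσs i s t hs his ht hit).symm
  · refine tendsto_nhds_unique (hconv 0 le_rfl) ?_
    simp only [hσs0, tendsto_const_nhds]
  · have hσt := (hb (σ t)).comp hR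
    have hx₀ := ((hb x₀).comp hR).add_const t
    have hdist : Tendsto (fun i => dist (σs i t) (σ t)) atTop (𝓝 0) :=
      tendsto_iff_dist_tendsto_zero.1 (hconv t ht)
    refine tendsto_nhds_unique hσt (hx₀.congr_dist ?_)
    refine squeeze_zero' (Eventually.of_forall fun _ => dist_nonneg) ?_ hdist
    filter_upwards [hLtop.eventually_ge_atTop t] with i hit
    have h := hσs i t (L i) ht hit (ht.trans hit) le_rfl
    rw [hσsL i, abs_sub_comm, abs_of_nonneg (sub_nonneg.2 hit), hL i] at h
    have hsub := abs_dist_sub_le (σs i t) (σ t) (γ (R i))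
    rw [Real.dist_eq, abs_sub_comm]
    refine le_of_eq_of_le (congrArg abs ?_) hsub
    simp only [Function.comp_apply]
    linarith
end

section
/- Let M : ℝ → ℝ be a function that is nonnegative and nondecreasing on [0, ∞). Suppose there exist constants A ≥ 0 and p ≥ 0 such that M(r) ≤ A · r^p for all r ≥ 1, and suppose there exist constants λ > 1, θ ∈ (0, 1), and R₀ ≥ 1 such that M(R) ≤ θ · λ^{−p} · M(λR) for all R ≥ R₀. Then M(r) = 0 for all r ≥ 0. -/
/-- Iteration lemma. If `M` is nonnegative and nondecreasing on `[0,∞)`,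
grows at most polynomially (`M r ≤ A r^p` for `r ≥ 1`), and satisfies the decay
inequality `M R ≤ θ λ^{-p} M (λ R)` for `R ≥ R₀` with `λ > 1` and `θ ∈ (0,1)`,
then `M ≡ 0` on `[0,∞)`. -/
theorem iteration_lemma (M : ℝ → ℝ)
    (hnonneg : ∀ r : ℝ, 0 ≤ r → 0 ≤ M r)
    (hmono : ∀ r s : ℝ, 0 ≤ r → r ≤ s → M r ≤ M s)
    (A p : ℝ) (hA : 0 ≤ A) (hp : 0 ≤ p)
    (hpoly : ∀ r : ℝ, 1 ≤ r → M r ≤ A * r ^ p)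
    (lam θ R₀ : ℝ) (hlam : 1 < lam) (hθ0 : 0 < θ) (hθ1 : θ < 1) (hR₀ : 1 ≤ R₀)
    (hdecay : ∀ R : ℝ, R₀ ≤ R → M R ≤ θ * lam ^ (-p) * M (lam * R)) :
    ∀ r : ℝ, 0 ≤ r → M r = 0 := by
  have bound : ∀ (k : ℕ) (R : ℝ), R₀ ≤ R → M R ≤ A * R ^ p * θ ^ k := by
    intro k
    induction k with
    | zero => exact fun R hR => by simpa using hpoly R (hR₀.trans hR)
    | succ k ih =>
      intro R hR
      have hlam0 : 0 < lam := by linarith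
      have hR0 : 0 < R := by linarith
      calc M R ≤ θ * lam ^ (-p) * M (lam * R) := hdecay R hR
        _ ≤ θ * lam ^ (-p) * (A * (lam * R) ^ p * θ ^ k) := by
          gcongr
          exact ih _ (by nlinarith)
        _ = A * R ^ p * θ ^ (k + 1) := by
          rw [Real.mul_rpow hlam0.le hR0.le, Real.rpow_neg hlam0.le]
          have := (Real.rpow_pos_of_pos hlam0 p).ne'
          field_simp
          ring
  intro r hr
  refine le_antisymm ?_ (hnonneg r hr)
  have hlim : Filter.Tendsto (fun k : ℕ => A * (max r R₀) ^ p * θ ^ k) Filter.atTop (nhds 0) := by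
    simpa using (tendsto_pow_atTop_nhds_zero_of_lt_one hθ0.le hθ1).const_mul (A * (max r R₀) ^ p)
  exact (hmono r _ hr (le_max_left r R₀)).trans
    (ge_of_tendsto' hlim fun k => bound k _ (le_max_right r R₀))
end
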